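/- Let T be a tree of order n(T) ≥ 3 with γ_t^{oi}(S(T)) = (4n(T) − l(T) − s(T))/3, let v_1 v_2 ⋯ v_{d+1} be a diametral path in T (a path of length equal to the diameter d of T), and suppose v_2 has degree at least 3 in T. Then the tree T' = T − {v_1} satisfies γ_t^{oi}(S(T')) = (4n(T') − l(T') − s(T'))/3. -/

import Mathlib

open SimpleGraph

universe u

/-- A total outer-independent dominating set: every vertex has a neighbor in `D`,
and the complement of `D` is an independent set. -/
def IsTOIDS {V : Type u} (G : SimpleGraph V) (D : Set V) : Prop :=
  (∀ v : V, ∃ u ∈ D, G.Adj v u) ∧ ∀ u ∉ D, ∀ w ∉ D, ¬ G.Adj u w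

/-- The total outer-independent domination number. -/
noncomputable def toidNumber {V : Type u} (G : SimpleGraph V) : ℕ :=
  sInf {n : ℕ | ∃ D : Set V, IsTOIDS G D ∧ D.ncard = n}

/-- The subdivision graph: each edge is replaced by a new vertex adjacent exactly to
its two endpoints. -/
def subdivision {V : Type u} (G : SimpleGraph V) : SimpleGraph (V ⊕ G.edgeSet) :=
  SimpleGraph.fromRel fun x y =>
    ∃ (v : V) (e : G.edgeSet), x = Sum.inl v ∧ y = Sum.inr e ∧ v ∈ (e : Sym2 V)

/-- A leaf: a vertex with exactly one neighbor. -/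
def IsLeafVert {V : Type u} (G : SimpleGraph V) (v : V) : Prop := ∃! u, G.Adj v u

/-- A support vertex: a vertex adjacent to a leaf. -/
def IsSupportVert {V : Type u} (G : SimpleGraph V) (v : V) : Prop :=
  ∃ u, G.Adj v u ∧ IsLeafVert G u

/-- A strong support vertex: a vertex adjacent to at least two leaves. -/
def IsStrongSupportVert {V : Type u} (G : SimpleGraph V) (v : V) : Prop :=
  ∃ u w, u ≠ w ∧ G.Adj v u ∧ G.Adj v w ∧ IsLeafVert G u ∧ IsLeafVert G w

/-- A strong leaf: a leaf adjacent to a strong support vertex. -/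
def IsStrongLeaf {V : Type u} (G : SimpleGraph V) (v : V) : Prop :=
  IsLeafVert G v ∧ ∃ u, G.Adj v u ∧ IsStrongSupportVert G u

/-- A weak leaf: a leaf that is not a strong leaf. -/
def IsWeakLeaf {V : Type u} (G : SimpleGraph V) (v : V) : Prop :=
  IsLeafVert G v ∧ ¬ IsStrongLeaf G v

/-- A semi-support vertex: neither a leaf nor a support vertex, but adjacent to a
support vertex. -/
def IsSemiSupportVert {V : Type u} (G : SimpleGraph V) (v : V) : Prop :=
  ¬ IsLeafVert G v ∧ ¬ IsSupportVert G v ∧ ∃ u, G.Adj v u ∧ IsSupportVert G u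

/-- The number of leaves, with the convention that `P₂` has exactly one leaf. -/
noncomputable def leafCount {V : Type u} (G : SimpleGraph V) : ℕ :=
  if Nat.card V = 2 then 1 else {v | IsLeafVert G v}.ncard

/-- The number of support vertices, with the convention that `P₂` has exactly one
support vertex. -/
noncomputable def supportCount {V : Type u} (G : SimpleGraph V) : ℕ :=
  if Nat.card V = 2 then 1 else {v | IsSupportVert G v}.ncard

/-- The graph obtained from `G` by attaching a path `P_r` to the vertex `v`:
the new vertices form a path `p₀ p₁ ⋯ p_{r-1}` and `v` is joined to the end `p₀`. -/
def attachPath {V : Type u} (G : SimpleGraph V) (v : V) (r : ℕ) :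
    SimpleGraph (V ⊕ Fin r) :=
  SimpleGraph.fromRel fun x y =>
    (∃ a b, x = Sum.inl a ∧ y = Sum.inl b ∧ G.Adj a b) ∨
    (∃ i j : Fin r, x = Sum.inr i ∧ y = Sum.inr j ∧ (j : ℕ) = (i : ℕ) + 1) ∨
    (∃ i : Fin r, x = Sum.inl v ∧ y = Sum.inr i ∧ (i : ℕ) = 0)

/-- The graph obtained from `G` by adding a disjoint copy of the tree `Q_r`
(`r` paths `P₃` joined to a central vertex) and identifying the central vertex
of `Q_r` with the vertex `v` of `G`. -/
def attachQ {V : Type u} (G : SimpleGraph V) (v : V) (r : ℕ) :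
    SimpleGraph (V ⊕ Fin r × Fin 3) :=
  SimpleGraph.fromRel fun x y =>
    (∃ a b, x = Sum.inl a ∧ y = Sum.inl b ∧ G.Adj a b) ∨
    (∃ i : Fin r, x = Sum.inl v ∧ y = Sum.inr (i, 0)) ∨
    (∃ (i : Fin r) (j k : Fin 3),
      x = Sum.inr (i, j) ∧ y = Sum.inr (i, k) ∧ (k : ℕ) = (j : ℕ) + 1)

/-- The family `F`: all trees obtainable from `P₂` by repeatedly
(F1) attaching `P₁` to a support vertex, (F2) attaching `P₂` to a support or
semi-support vertex, (F3) attaching `P₃` to a weak leaf. -/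
inductive InFamilyF : {W : Type u} → SimpleGraph W → Prop
  | base {W : Type u} (G : SimpleGraph W) (e : G ≃g SimpleGraph.pathGraph 2) :
      InFamilyF G
  | op1 {W : Type u} {G' : SimpleGraph W} {v : W} (hv : IsSupportVert G' v)
      (hF : InFamilyF G') {U : Type u} (G : SimpleGraph U)
      (e : G ≃g attachPath G' v 1) : InFamilyF G
  | op2 {W : Type u} {G' : SimpleGraph W} {v : W}
      (hv : IsSupportVert G' v ∨ IsSemiSupportVert G' v)
      (hF : InFamilyF G') {U : Type u} (G : SimpleGraph U)
      (e : G ≃g attachPath G' v 2) : InFamilyF G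
  | op3 {W : Type u} {G' : SimpleGraph W} {v : W} (hv : IsWeakLeaf G' v)
      (hF : InFamilyF G') {U : Type u} (G : SimpleGraph U)
      (e : G ≃g attachPath G' v 3) : InFamilyF G

/-- The family `𝒯`: all trees obtainable from `P₂` by repeatedly
(O1) attaching `P₁` to a support vertex, (O2) attaching `P₃` to a support vertex or a
weak leaf, (O3) adding a copy of `Q_r` (`r ≥ 2`) identifying its central vertex with a
weak leaf. -/
inductive InFamilyT : {W : Type u} → SimpleGraph W → Prop
  | base {W : Type u} (G : SimpleGraph W) (e : G ≃g SimpleGraph.pathGraph 2) :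
      InFamilyT G
  | op1 {W : Type u} {G' : SimpleGraph W} {v : W} (hv : IsSupportVert G' v)
      (hF : InFamilyT G') {U : Type u} (G : SimpleGraph U)
      (e : G ≃g attachPath G' v 1) : InFamilyT G
  | op2 {W : Type u} {G' : SimpleGraph W} {v : W}
      (hv : IsSupportVert G' v ∨ IsWeakLeaf G' v)
      (hF : InFamilyT G') {U : Type u} (G : SimpleGraph U)
      (e : G ≃g attachPath G' v 3) : InFamilyT G
  | op3 {W : Type u} {G' : SimpleGraph W} {v : W} (hv : IsWeakLeaf G' v)
      (hF : InFamilyT G') {r : ℕ} (hr : 2 ≤ r) {U : Type u} (G : SimpleGraph U)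
      (e : G ≃g attachQ G' v r) : InFamilyT G

@[simp] lemma subdivision_adj_inl_inl {V : Type u} {G : SimpleGraph V} {v w : V} :
    ¬ (subdivision G).Adj (Sum.inl v) (Sum.inl w) := by
  simp [subdivision]

@[simp] lemma subdivision_adj_inr_inr {V : Type u} {G : SimpleGraph V} {e f : G.edgeSet} :
    ¬ (subdivision G).Adj (Sum.inr e) (Sum.inr f) := by
  simp [subdivision]

@[simp] lemma subdivision_adj_inl_inr {V : Type u} {G : SimpleGraph V} {v : V} {e : G.edgeSet} :
    (subdivision G).Adj (Sum.inl v) (Sum.inr e) ↔ v ∈ (e : Sym2 V) := by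
  simp only [subdivision, fromRel_adj]
  grind

@[simp] lemma subdivision_adj_inr_inl {V : Type u} {G : SimpleGraph V} {v : V} {e : G.edgeSet} :
    (subdivision G).Adj (Sum.inr e) (Sum.inl v) ↔ v ∈ (e : Sym2 V) := by
  rw [adj_comm, subdivision_adj_inl_inr]

/-- A graph embedding induces an embedding of the subdivision graphs. -/
def subdivisionEmbedding {V W : Type u} {G : SimpleGraph V} {H : SimpleGraph W} (f : G ↪g H) :
    subdivision G ↪g subdivision H where
  toFun := Sum.map f f.mapEdgeSet
  inj' := f.injective.sumMap f.mapEdgeSet.injective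
  map_rel_iff' := by
    have key (v : V) (e : Sym2 V) : f v ∈ e.map f ↔ v ∈ e := by
      simp [Sym2.mem_map]
    rintro (v | ⟨e, he⟩) (w | ⟨e', he'⟩) <;>
      simp [SimpleGraph.Embedding.mapEdgeSet, SimpleGraph.Hom.mapEdgeSet, key]

/-- If no vertex is isolated then the whole vertex set is a TOIDS. -/
lemma isTOIDS_univ {V : Type u} {G : SimpleGraph V} (h : ∀ v, ∃ u, G.Adj v u) :
    IsTOIDS G Set.univ :=
  ⟨fun v => by simpa using h v, by simp⟩

lemma exists_subdivision_adj {V : Type u} {G : SimpleGraph V} (h : ∀ v, ∃ u, G.Adj v u)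
    (x : V ⊕ G.edgeSet) : ∃ y, (subdivision G).Adj x y := by
  rcases x with v | ⟨e, he⟩
  · obtain ⟨u, hu⟩ := h v
    exact ⟨Sum.inr ⟨s(v, u), hu⟩, by simp⟩
  · induction e with
    | _ x y => exact ⟨Sum.inl x, by simp⟩

lemma toidNumber_le {V : Type u} {G : SimpleGraph V} {D : Set V} (hD : IsTOIDS G D) :
    toidNumber G ≤ D.ncard :=
  Nat.sInf_le ⟨D, hD, rfl⟩

lemma exists_isTOIDS_ncard_eq {V : Type u} {G : SimpleGraph V} {D : Set V} (hD : IsTOIDS G D) :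
    ∃ D', IsTOIDS G D' ∧ D'.ncard = toidNumber G :=
  Nat.sInf_mem (s := {n : ℕ | ∃ D : Set V, IsTOIDS G D ∧ D.ncard = n}) ⟨_, D, hD, rfl⟩

/-- Removing one of two pendant paths `A E`, `C F` of length two at a common vertex `S` decreases
the total outer-independent domination number by exactly one. -/
lemma toidNumber_of_two_pendant_paths {V W : Type u} [Finite V] {H : SimpleGraph V}
    {H' : SimpleGraph W} (j : H' ↪g H) {A E S F C : V}
    (hr : ∀ x, x ∈ Set.range j ↔ x ≠ A ∧ x ≠ E)
    (hA : ∀ x, H.Adj A x ↔ x = E) (hE : ∀ x, H.Adj E x ↔ x = A ∨ x = S)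
    (hF : ∀ x, H.Adj F x ↔ x = C ∨ x = S) (hC : ∀ x, H.Adj C x ↔ x = F)
    (hAC : A ≠ C) (hEF : E ≠ F) (hAF : A ≠ F)
    (hiso : ∀ x, ∃ y, H.Adj x y) :
    toidNumber H = toidNumber H' + 1 := by
  classical
  have hCE : C ≠ E := by
    rintro rfl
    exact hAF ((hC A).1 ((hE A).2 (Or.inl rfl)))
  have hCF : C ≠ F := ((hC F).2 rfl).ne
  have lift (x : V) (h1 : x ≠ A) (h2 : x ≠ E) : ∃ y, j y = x := (hr x).2 ⟨h1, h2⟩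
  have hne (y : W) : j y ≠ A ∧ j y ≠ E := (hr _).1 ⟨y, rfl⟩
  have hAE' (x : V) : H.Adj x A ↔ x = E := by rw [adj_comm, hA]
  have hE' (x : V) : H.Adj x E ↔ x = A ∨ x = S := by rw [adj_comm, hE]
  have hC' (x : V) : H.Adj x C ↔ x = F := by rw [adj_comm, hC]
  obtain ⟨D, hD, hDcard⟩ := exists_isTOIDS_ncard_eq (isTOIDS_univ hiso)
  have hED : E ∈ D := by
    obtain ⟨u, hu, h⟩ := hD.1 A
    rwa [(hA u).1 h] at hu
  have hFD : F ∈ D := by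
    obtain ⟨u, hu, h⟩ := hD.1 C
    rwa [(hC u).1 h] at hu
  have hpre : IsTOIDS H' (j ⁻¹' D) := by
    refine ⟨fun y => ?_, fun u hu v hv huv => hD.2 _ hu _ hv (j.map_adj_iff.2 huv)⟩
    by_cases hyS : j y = S
    · obtain ⟨f, hf⟩ := lift F hAF.symm hEF.symm
      refine ⟨f, by simpa [hf] using hFD, j.map_adj_iff.1 ?_⟩
      rw [hf, hyS, adj_comm, hF]
      exact Or.inr rfl
    · obtain ⟨u, hu, h⟩ := hD.1 (j y)
      obtain ⟨z, rfl⟩ := lift u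
        (by rintro rfl; exact (hne y).2 ((hAE' _).1 h))
        (by rintro rfl; exact ((hE' _).1 h).elim (hne y).1 hyS)
      exact ⟨z, hu, j.map_adj_iff.1 h⟩
  have hcard1 : (j ⁻¹' D).ncard + 1 ≤ D.ncard := by
    rw [← Set.ncard_image_of_injective _ j.injective, ← Set.ncard_sdiff_singleton_add_one hED]
    gcongr
    · exact Set.toFinite _
    · rintro _ ⟨y, hy, rfl⟩
      exact ⟨hy, (hne y).2⟩
  obtain ⟨D', hD', hDcard'⟩ := exists_isTOIDS_ncard_eq hpre
  have hmem (y : W) : j y ∈ j '' D' ↔ y ∈ D' := j.injective.mem_set_image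
  have hFD' : F ∈ j '' D' := by
    obtain ⟨c, hc⟩ := lift C hAC.symm hCE
    obtain ⟨u, hu, h⟩ := hD'.1 c
    rw [← (hC (j u)).1 (by rw [← hc]; exact j.map_adj_iff.2 h)]
    exact ⟨u, hu, rfl⟩
  have hdom (x : V) (h1 : x ≠ A) (h2 : x ≠ E) : ∃ u ∈ j '' D', H.Adj x u := by
    obtain ⟨y, rfl⟩ := lift x h1 h2
    obtain ⟨u, hu, h⟩ := hD'.1 y
    exact ⟨j u, ⟨u, hu, rfl⟩, j.map_adj_iff.2 h⟩
  have hind (x y : V) (hx : x ≠ A ∧ x ≠ E) (hy : y ≠ A ∧ y ≠ E) (hx' : x ∉ j '' D')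
      (hy' : y ∉ j '' D') : ¬ H.Adj x y := by
    obtain ⟨x, rfl⟩ := lift x hx.1 hx.2
    obtain ⟨y, rfl⟩ := lift y hy.1 hy.2
    rw [hmem] at hx' hy'
    exact fun h => hD'.2 x hx' y hy' (j.map_adj_iff.1 h)
  -- A set of the same size as `D'` which contains `S`.
  obtain ⟨B, hBcard, hSB, hFB, hBdom, hBind⟩ : ∃ B : Set V, B.ncard ≤ D'.ncard ∧ S ∈ B ∧ F ∈ B ∧
      (∀ x, x ≠ A → x ≠ E → ∃ u ∈ B, H.Adj x u) ∧
      (∀ x y, x ≠ A ∧ x ≠ E → y ≠ A ∧ y ≠ E → x ∉ B → y ∉ B → ¬ H.Adj x y) := by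
    by_cases hS : S ∈ j '' D'
    · exact ⟨j '' D', (Set.ncard_image_of_injective _ j.injective).le, hS, hFD', hdom, hind⟩
    · have hCD' : C ∈ j '' D' := by
        obtain ⟨u, hu, h⟩ := hdom F hAF.symm hEF.symm
        rcases (hF u).1 h with rfl | rfl
        · exact hu
        · exact absurd hu hS
      refine ⟨insert S ((j '' D') \ {C}), ?_, Set.mem_insert _ _,
        Or.inr ⟨hFD', hCF.symm⟩, fun x h1 h2 => ?_, fun x y hx hy hx' hy' hxy => ?_⟩
      · refine (Set.ncard_insert_le _ _).trans ?_
        rw [Set.ncard_sdiff_singleton_add_one hCD', Set.ncard_image_of_injective _ j.injective]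
      · obtain ⟨u, hu, h⟩ := hdom x h1 h2
        by_cases hu' : u = C
        · refine ⟨S, Set.mem_insert _ _, ?_⟩
          rw [hu', hC'] at h
          rw [h, hF]
          exact Or.inr rfl
        · exact ⟨u, Or.inr ⟨hu, hu'⟩, h⟩
      · have aux (z : V) (hz : z ∉ insert S ((j '' D') \ {C})) : z ∉ j '' D' ∨ z = C := by
          by_contra! h
          exact hz (Or.inr h)
        have hF' : F ∈ insert S ((j '' D') \ {C}) := Or.inr ⟨hFD', hCF.symm⟩
        rcases aux x hx' with h1 | rfl
        · rcases aux y hy' with h2 | rfl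
          · exact hind x y hx hy h1 h2 hxy
          · rw [hC'] at hxy
            exact hx' (hxy ▸ hF')
        · rw [hC] at hxy
          exact hy' (hxy ▸ hF')
  have hext : IsTOIDS H (insert E B) := by
    refine ⟨fun x => ?_, fun x hx y hy hxy => ?_⟩
    · by_cases h1 : x = A
      · exact ⟨E, Set.mem_insert _ _, by rw [h1, hA]⟩
      by_cases h2 : x = E
      · exact ⟨S, Or.inr hSB, by rw [h2, hE]; exact Or.inr rfl⟩
      obtain ⟨u, hu, h⟩ := hBdom x h1 h2
      exact ⟨u, Or.inr hu, h⟩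
    · have hE1 : E ∈ insert E B := Set.mem_insert _ _
      have hxE : x ≠ E := fun h => hx (h ▸ hE1)
      have hyE : y ≠ E := fun h => hy (h ▸ hE1)
      have hxA : x ≠ A := by
        rintro rfl
        exact hyE ((hA y).1 hxy)
      have hyA : y ≠ A := by
        rintro rfl
        exact hxE ((hAE' x).1 hxy)
      exact hBind x y ⟨hxA, hxE⟩ ⟨hyA, hyE⟩ (fun h => hx (Or.inr h)) (fun h => hy (Or.inr h)) hxy
  have h1 := toidNumber_le hpre
  have h2 := (toidNumber_le hext).trans (Set.ncard_insert_le _ _)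
  omega

/-- In a tree, a path is no longer than the diameter. -/
lemma SimpleGraph.IsTree.length_le_diam {V : Type u} [Finite V] {T : SimpleGraph V} (hT : T.IsTree)
    {x y : V} {p : T.Walk x y} (hp : p.IsPath) : p.length ≤ T.diam := by
  have := hT.connected.nonempty
  obtain ⟨q, hq, hlen⟩ := hT.connected.exists_path_of_dist x y
  rw [(hT.existsUnique_path x y).unique hp hq, hlen]
  exact dist_le_diam (connected_iff_ediam_ne_top.1 hT.connected)

/-- If `p` starts at `s` and extending it by one vertex gives a longest path, then every neighbor
of `s` other than the second vertex of `p` is a leaf. -/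
lemma SimpleGraph.IsTree.adj_iff_of_adj_of_diam_le {V : Type u} [Finite V] {T : SimpleGraph V}
    (hT : T.IsTree) {s b x : V} {p : T.Walk s b} (hp : p.IsPath) (hlen : T.diam ≤ p.length + 1)
    (hsx : T.Adj s x) (hx : x ∉ p.support) (y : V) : T.Adj x y ↔ y = s := by
  refine ⟨fun hxy => ?_, fun h => h ▸ hsx.symm⟩
  by_contra hys
  have hq : (Walk.cons hsx.symm p).IsPath := hp.cons hx
  have hy : y ∉ (Walk.cons hsx.symm p).support := fun h =>
    hys (by simpa using hT.isAcyclic.eq_snd_of_adj_start hq hxy h)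
  have := hT.length_le_diam (hq.cons hy (h := hxy.symm))
  simp at this
  omega

section DeleteLeaf

variable {V : Type u} {T : SimpleGraph V} {a c s t : V}

/-- Deleting a leaf at `s` does not change which of the other vertices are leaves, if `s` has at
least two other neighbors. -/
lemma isLeafVert_induce_ne_iff (ha : ∀ y, T.Adj a y ↔ y = s) (hsc : T.Adj s c) (hst : T.Adj s t)
    (hac : a ≠ c) (hat : a ≠ t) (hct : c ≠ t) (x : {x : V | x ≠ a}) :
    IsLeafVert (T.induce {x : V | x ≠ a}) x ↔ IsLeafVert T x := by
  obtain ⟨x, hxa⟩ := x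
  by_cases hxs : x = s
  · subst hxs
    constructor
    · rintro ⟨u, -, hu⟩
      have h1 := hu ⟨c, hac.symm⟩ (by simpa using hsc)
      have h2 := hu ⟨t, hat.symm⟩ (by simpa using hst)
      exact absurd (congrArg Subtype.val (h1.trans h2.symm)) hct
    · rintro ⟨u, -, hu⟩
      exact absurd ((hu c hsc).trans (hu t hst).symm) hct
  · have hne (y : V) (h : T.Adj x y) : y ≠ a := by
      rintro rfl
      exact hxs ((ha x).1 h.symm)
    constructor
    · rintro ⟨⟨u, hua⟩, hu, huniq⟩
      exact ⟨u, by simpa using hu, fun y hy =>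
        congrArg Subtype.val (huniq ⟨y, hne y hy⟩ (by simpa using hy))⟩
    · rintro ⟨u, hu, huniq⟩
      exact ⟨⟨u, hne u hu⟩, by simpa using hu, fun y hy =>
        Subtype.ext (huniq y (by simpa using hy))⟩

lemma ncard_isLeafVert_eq_induce_ne_add_one [Finite V] (ha : ∀ y, T.Adj a y ↔ y = s)
    (hsc : T.Adj s c) (hst : T.Adj s t) (hac : a ≠ c) (hat : a ≠ t) (hct : c ≠ t) :
    {v | IsLeafVert T v}.ncard =
      {v | IsLeafVert (T.induce {x : V | x ≠ a}) v}.ncard + 1 := by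
  have hleaf : a ∈ {v | IsLeafVert T v} := ⟨s, (ha s).2 rfl, fun y hy => (ha y).1 hy⟩
  rw [← Set.ncard_sdiff_singleton_add_one hleaf,
    ← Set.ncard_image_of_injective {v | IsLeafVert (T.induce {x : V | x ≠ a}) v}
      Subtype.val_injective]
  congr 2
  ext x
  simp only [Set.mem_sdiff, Set.mem_ofPred_eq, Set.mem_singleton_iff, Set.mem_image]
  constructor
  · rintro ⟨h, hxa⟩
    exact ⟨⟨x, hxa⟩, (isLeafVert_induce_ne_iff ha hsc hst hac hat hct _).2 h, rfl⟩
  · rintro ⟨y, hy, rfl⟩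
    exact ⟨(isLeafVert_induce_ne_iff ha hsc hst hac hat hct _).1 hy, y.2⟩

lemma ncard_isSupportVert_eq_induce_ne (ha : ∀ y, T.Adj a y ↔ y = s)
    (hc : ∀ y, T.Adj c y ↔ y = s) (hst : T.Adj s t) (hac : a ≠ c) (hat : a ≠ t) (hct : c ≠ t) :
    {v | IsSupportVert T v}.ncard =
      {v | IsSupportVert (T.induce {x : V | x ≠ a}) v}.ncard := by
  have hsc : T.Adj s c := ((hc s).2 rfl).symm
  have hleaf := isLeafVert_induce_ne_iff ha hsc hst hac hat hct
  rw [← Set.ncard_image_of_injective {v | IsSupportVert (T.induce {x : V | x ≠ a}) v}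
      Subtype.val_injective]
  congr 1
  ext x
  simp only [Set.mem_ofPred_eq, Set.mem_image]
  constructor
  · rintro ⟨u, hxu, hu⟩
    have hxa : x ≠ a := by
      rintro rfl
      rw [(ha u).1 hxu] at hu
      exact hct (hu.unique hsc hst)
    by_cases hua : u = a
    · have hxs : x = s := (ha x).1 (hua ▸ hxu.symm)
      exact ⟨⟨x, hxa⟩, ⟨⟨c, hac.symm⟩, by simpa [hxs] using hsc,
        (hleaf _).2 ⟨s, (hc s).2 rfl, fun y hy => (hc y).1 hy⟩⟩, rfl⟩
    · exact ⟨⟨x, hxa⟩, ⟨⟨u, hua⟩, by simpa using hxu, (hleaf _).2 hu⟩, rfl⟩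
  · rintro ⟨y, ⟨u, hyu, hu⟩, rfl⟩
    exact ⟨u, by simpa using hyu, (hleaf u).1 hu⟩

/-- Deleting one of two leaves at a common vertex decreases the total outer-independent domination
number of the subdivision graph by exactly one. -/
lemma toidNumber_subdivision_eq_induce_ne_add_one [Finite V] (ha : ∀ y, T.Adj a y ↔ y = s)
    (hc : ∀ y, T.Adj c y ↔ y = s) (hac : a ≠ c) (hiso : ∀ v, ∃ u, T.Adj v u) :
    toidNumber (subdivision T) =
      toidNumber (subdivision (T.induce {x : V | x ≠ a})) + 1 := by
  have has : T.Adj a s := (ha s).2 rfl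
  have hcs : T.Adj c s := (hc s).2 rfl
  have edge_of_mem {l : V} (hl : ∀ y, T.Adj l y ↔ y = s) (e : Sym2 V) (he : e ∈ T.edgeSet) :
      l ∈ e ↔ e = s(l, s) := by
    constructor
    · intro h
      obtain ⟨y, rfl⟩ := h
      rw [mem_edgeSet, hl] at he
      rw [he]
    · rintro rfl
      simp
  refine toidNumber_of_two_pendant_paths
    (subdivisionEmbedding (Embedding.induce {x : V | x ≠ a}))
    (A := Sum.inl a) (E := Sum.inr ⟨s(a, s), has⟩) (S := Sum.inl s)
    (F := Sum.inr ⟨s(c, s), hcs⟩) (C := Sum.inl c) ?_ ?_ ?_ ?_ ?_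
    (by simpa using hac) ?_ (by simp) (exists_subdivision_adj hiso)
  · rintro (x | ⟨e, he⟩)
    · constructor
      · rintro ⟨y | y, hy⟩
        · obtain rfl : (y : V) = x := Sum.inl_injective hy
          exact ⟨fun h => y.2 (Sum.inl_injective h), by simp⟩
        · exact absurd hy (by simp [subdivisionEmbedding])
      · rintro ⟨h, -⟩
        exact ⟨Sum.inl ⟨x, by simpa using h⟩, rfl⟩
    · constructor
      · rintro ⟨y | ⟨y, hy'⟩, hy⟩
        · exact absurd hy (by simp [subdivisionEmbedding])
        · refine ⟨by simp, ?_⟩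
          intro h
          have h1 : y.map Subtype.val = e := congrArg Subtype.val (Sum.inr_injective hy)
          have h2 : e = s(a, s) := congrArg Subtype.val (Sum.inr_injective h)
          have h3 : a ∈ y.map Subtype.val := by simp [h1, h2]
          obtain ⟨z, -, hz⟩ := Sym2.mem_map.1 h3
          exact z.2 hz
      · rintro ⟨-, h⟩
        have hae : a ∉ e := by
          rw [edge_of_mem ha e he]
          rintro rfl
          exact h rfl
        induction e with
        | _ x y =>
          simp only [Sym2.mem_iff, not_or] at hae
          exact ⟨Sum.inr ⟨s(⟨x, Ne.symm hae.1⟩, ⟨y, Ne.symm hae.2⟩), he⟩, rfl⟩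
  · rintro (x | ⟨e, he⟩)
    · simp
    · simpa [Subtype.ext_iff] using edge_of_mem ha e he
  · rintro (x | ⟨e, he⟩) <;> simp
  · rintro (x | ⟨e, he⟩) <;> simp
  · rintro (x | ⟨e, he⟩)
    · simp
    · simpa [Subtype.ext_iff] using edge_of_mem hc e he
  · simp [Subtype.ext_iff, hac, has.ne]

end DeleteLeaf

theorem claimI_lower {V : Type u} [Fintype V] [DecidableEq V]
    (T : SimpleGraph V) [DecidableRel T.Adj] (hT : T.IsTree) (hn : 3 ≤ Nat.card V)
    (heq : (toidNumber (subdivision T) : ℚ) = (4 * (Nat.card V : ℚ) - leafCount T - supportCount T) / 3)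
    {a b : V} (w : T.Walk a b) (hw : w.IsPath) (hd : w.length = T.diam)
    (hdeg : 3 ≤ T.degree (w.getVert 1)) :
    (toidNumber (subdivision (T.induce {x : V | x ≠ a})) : ℚ) = (4 * (Nat.card {x : V | x ≠ a} : ℚ) - leafCount (T.induce {x : V | x ≠ a}) - supportCount (T.induce {x : V | x ≠ a})) / 3 := by
  have : Nontrivial V := (Finite.one_lt_card_iff_nontrivial).1 (by omega)
  have hiso (v : V) : ∃ u, T.Adj v u := hT.connected.preconnected.exists_adj_of_nontrivial v
  cases w with
  | nil =>
    obtain ⟨u, hu⟩ := hiso a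
    have := hT.length_le_diam (Path.singleton hu).2
    rw [← hd] at this
    simp at this
  | @cons _ s _ hadj p =>
    rw [Walk.cons_isPath_iff] at hw
    replace hdeg : 3 ≤ T.degree s := by
      convert hdeg
      simp
    rw [Walk.length_cons] at hd
    have ha := hT.adj_iff_of_adj_of_diam_le hw.1 hd.ge hadj.symm hw.2
    obtain ⟨c, hc, hcap⟩ : ∃ c ∈ T.neighborFinset s, c ∉ ({a, p.snd} : Finset V) :=
      Finset.exists_mem_notMem_of_card_lt_card
        (Finset.card_le_two.trans_lt (by rw [card_neighborFinset_eq_degree]; omega))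
    simp only [mem_neighborFinset, Finset.mem_insert, Finset.mem_singleton, not_or] at hc hcap
    obtain ⟨t, ht, htac⟩ : ∃ t ∈ T.neighborFinset s, t ∉ ({a, c} : Finset V) :=
      Finset.exists_mem_notMem_of_card_lt_card
        (Finset.card_le_two.trans_lt (by rw [card_neighborFinset_eq_degree]; omega))
    simp only [mem_neighborFinset, Finset.mem_insert, Finset.mem_singleton, not_or] at ht htac
    have hcp : c ∉ p.support := fun h => hcap.2 (hT.isAcyclic.eq_snd_of_adj_start hw.1 hc h)
    have hc' := hT.adj_iff_of_adj_of_diam_le hw.1 hd.ge hc hcp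
    have hac : a ≠ c := Ne.symm hcap.1
    have hat : a ≠ t := Ne.symm htac.1
    have hct : c ≠ t := Ne.symm htac.2
    have hcardT : Nat.card V = Nat.card {x : V | x ≠ a} + 1 := by
      have := Set.ncard_add_ncard_compl {x : V | x ≠ a}
      have h1 : {x : V | x ≠ a}ᶜ = {a} := by ext; simp
      rw [h1, Set.ncard_singleton] at this
      exact this.symm
    have hdegV : T.degree s < Nat.card V := by
      rw [Nat.card_eq_fintype_card]
      exact T.degree_lt_card_verts s
    have htoid := toidNumber_subdivision_eq_induce_ne_add_one ha hc' hac hiso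
    have hleaf : leafCount T = leafCount (T.induce {x : V | x ≠ a}) + 1 := by
      rw [leafCount, leafCount, if_neg (by omega), if_neg (by omega)]
      exact ncard_isLeafVert_eq_induce_ne_add_one ha hc ht hac hat hct
    have hsupp : supportCount T = supportCount (T.induce {x : V | x ≠ a}) := by
      rw [supportCount, supportCount, if_neg (by omega), if_neg (by omega)]
      exact ncard_isSupportVert_eq_induce_ne ha hc' ht hac hat hct
    rw [htoid, hleaf, hsupp, hcardT] at heq
    push_cast at heq
    linarith
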